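/- For all real-valued Schwartz functions w₁, w₂ on ℝ²: ∫_{ℝ²} G(ξ)^{−1} [ (Λw₁)(ξ) w₂(ξ) + w₁(ξ) (Λw₂)(ξ) ] dξ = 0; that is, the operator Λ is skew-symmetric with respect to the inner product ⟨w₁,w₂⟩ = ∫_{ℝ²} G(ξ)^{−1} w₁(ξ) w₂(ξ) dξ. -/

import Mathlib

open MeasureTheory Filter Real
open scoped ENNReal Topology

noncomputable section

abbrev R2 := EuclideanSpace ℝ (Fin 2)

/-- `x^⊥ = (-x₂, x₁)`. -/
def perp (x : R2) : R2 := (WithLp.equiv 2 (Fin 2 → ℝ)).symm ![-x 1, x 0]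

/-- Biot–Savart velocity `u = K * ω`. -/
def biotSavart (ω : R2 → ℝ) (x : R2) : R2 :=
  (2 * π)⁻¹ • ∫ y : R2, (ω y / ‖x - y‖ ^ 2) • perp (x - y)

/-- Gaussian Oseen vorticity profile `G(ξ) = (4π)⁻¹ e^{-|ξ|²/4}`. -/
def Gv (ξ : R2) : ℝ := (4 * π)⁻¹ * Real.exp (-‖ξ‖ ^ 2 / 4)

/-- Oseen velocity profile `v^G(ξ) = (2π)⁻¹ (ξ^⊥/|ξ|²)(1 - e^{-|ξ|²/4})`. -/
def vG (ξ : R2) : R2 :=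
  ((2 * π)⁻¹ * (1 - Real.exp (-‖ξ‖ ^ 2 / 4)) / ‖ξ‖ ^ 2) • perp ξ

/-- The operator `(Λw)(ξ) = v^G(ξ)·∇w(ξ) + (K*w)(ξ)·∇G(ξ)`. -/
def Lam (w : R2 → ℝ) (ξ : R2) : ℝ :=
  fderiv ℝ w ξ (vG ξ) + fderiv ℝ Gv ξ (biotSavart w ξ)

lemma perp_apply_zero (x : R2) : perp x 0 = -x 1 := rfl

lemma perp_apply_one (x : R2) : perp x 1 = x 0 := rfl

lemma inner_R2 (x y : R2) : inner ℝ x y = x 0 * y 0 + x 1 * y 1 := by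
  rw [PiLp.inner_apply, Fin.sum_univ_two]
  simp [mul_comm]

lemma norm_sq_R2 (x : R2) : ‖x‖ ^ 2 = x 0 ^ 2 + x 1 ^ 2 := by
  rw [EuclideanSpace.norm_sq_eq, Fin.sum_univ_two]
  simp

lemma inner_perp_self (x : R2) : inner ℝ x (perp x) = 0 := by
  rw [inner_R2, perp_apply_zero, perp_apply_one]
  ring

lemma perp_neg (x : R2) : perp (-x) = -perp x := by
  ext i
  fin_cases i <;> simp [perp]

lemma norm_perp (x : R2) : ‖perp x‖ = ‖x‖ := by
  rw [← sq_eq_sq₀ (norm_nonneg _) (norm_nonneg _), norm_sq_R2, norm_sq_R2, perp_apply_zero,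
    perp_apply_one]
  ring

@[fun_prop]
lemma continuous_perp : Continuous perp := by
  refine (PiLp.continuous_toLp 2 _).comp (continuous_pi fun i ↦ ?_)
  fin_cases i <;> simp <;> fun_prop

/-- The linear map `x ↦ (cos t) x + (sin t) x^⊥`, that is, rotation by the angle `t`. -/
def rotate (t : ℝ) (x : R2) : R2 := Real.cos t • x + Real.sin t • perp x

lemma rotate_apply_zero (t : ℝ) (x : R2) :
    rotate t x 0 = Real.cos t * x 0 - Real.sin t * x 1 := by
  simp [rotate, perp_apply_zero, sub_eq_add_neg]

lemma rotate_apply_one (t : ℝ) (x : R2) :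
    rotate t x 1 = Real.cos t * x 1 + Real.sin t * x 0 := by
  simp [rotate, perp_apply_one]

lemma norm_rotate (t : ℝ) (x : R2) : ‖rotate t x‖ = ‖x‖ := by
  rw [← sq_eq_sq₀ (norm_nonneg _) (norm_nonneg _), norm_sq_R2, norm_sq_R2, rotate_apply_zero,
    rotate_apply_one]
  linear_combination (x 0 ^ 2 + x 1 ^ 2) * Real.sin_sq_add_cos_sq t

lemma continuous_rotate : Continuous fun p : ℝ × R2 ↦ rotate p.1 p.2 := by
  unfold rotate
  fun_prop

/-- Rotation by the angle `t` as a linear isometry. -/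
def rotateIsometry (t : ℝ) : R2 →ₗᵢ[ℝ] R2 where
  toFun := rotate t
  map_add' x y := by
    ext i
    fin_cases i <;> simp [rotate_apply_zero, rotate_apply_one] <;> ring
  map_smul' c x := by
    ext i
    fin_cases i <;> simp [rotate_apply_zero, rotate_apply_one] <;> ring
  norm_map' := norm_rotate t

lemma measurePreserving_rotate (t : ℝ) : MeasurePreserving (rotate t) :=
  ((rotateIsometry t).toLinearIsometryEquiv rfl).measurePreserving

lemma hasDerivAt_rotate (x : R2) (t : ℝ) :
    HasDerivAt (fun s ↦ rotate s x) (perp (rotate t x)) t := by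
  have h := ((Real.hasDerivAt_cos t).smul_const x).add
    ((Real.hasDerivAt_sin t).smul_const (perp x))
  convert! h using 1
  ext i
  fin_cases i <;> simp [rotate_apply_zero, rotate_apply_one, perp_apply_zero, perp_apply_one]
  ring

lemma integral_eq_zero_of_forall_integral_rotate_eq_zero {f : R2 → ℝ} (hf : Integrable f)
    (h : ∀ x, ∫ t in (0)..(2 * π), f (rotate t x) = 0) : ∫ x, f x = 0 := by
  set μ : Measure ℝ := volume.restrict (Set.Ioc 0 (2 * π))
  have hmp : MeasurePreserving (fun p : ℝ × R2 ↦ (p.1, rotate p.1 p.2))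
      (μ.prod volume) (μ.prod volume) :=
    (MeasurePreserving.id μ).skew_product (g := rotate) continuous_rotate.measurable
      (ae_of_all _ fun t ↦ (measurePreserving_rotate t).map_eq)
  have hint : Integrable (fun p : ℝ × R2 ↦ f (rotate p.1 p.2)) (μ.prod volume) :=
    hmp.integrable_comp_of_integrable (hf.comp_snd μ)
  have hswap := integral_integral_swap (f := fun t x ↦ f (rotate t x)) hint
  have hconst (t : ℝ) : ∫ x, f (rotate t x) = ∫ x, f x :=
    (measurePreserving_rotate t).integral_comp
      ((rotateIsometry t).toLinearIsometryEquiv rfl).toHomeomorph.measurableEmbedding f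
  have hzero (x : R2) : ∫ t, f (rotate t x) ∂μ = 0 := by
    rw [← h x, intervalIntegral.integral_of_le Real.two_pi_pos.le]
  simp only [hconst, hzero, integral_const, smul_eq_mul, mul_zero] at hswap
  refine (mul_eq_zero.mp hswap).resolve_left ?_
  simp [μ, Measure.real, Real.pi_pos.le, Real.pi_ne_zero]

/-- An integrable radial multiple of an angular derivative has zero integral. -/
lemma integral_radial_mul_fderiv_perp {m : ℝ → ℝ} {p : R2 → ℝ} (hp : ContDiff ℝ 1 p)
    (hint : Integrable fun x ↦ m ‖x‖ * fderiv ℝ p x (perp x)) :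
    ∫ x, m ‖x‖ * fderiv ℝ p x (perp x) = 0 := by
  refine integral_eq_zero_of_forall_integral_rotate_eq_zero hint fun x ↦ ?_
  have hrot : Continuous fun t ↦ rotate t x := by
    unfold rotate
    fun_prop
  simp only [norm_rotate, intervalIntegral.integral_const_mul]
  rw [intervalIntegral.integral_eq_sub_of_hasDerivAt (f := fun t ↦ p (rotate t x))]
  · simp [rotate]
  · exact fun t _ ↦ ((hp.differentiable one_ne_zero _).hasFDerivAt).comp_hasDerivAt t
      (hasDerivAt_rotate x t)
  · exact (((hp.continuous_fderiv one_ne_zero).comp hrot).clm_apply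
      (continuous_perp.comp hrot)).intervalIntegrable _ _

/-- The kernel `z ↦ z^⊥ / |z|²`, which is `2π` times the Biot–Savart kernel. -/
def perpKernel (z : R2) : R2 := (‖z‖ ^ 2)⁻¹ • perp z

lemma norm_perpKernel (z : R2) : ‖perpKernel z‖ = ‖z‖⁻¹ := by
  rw [perpKernel, norm_smul, norm_perp, norm_inv, norm_pow, norm_norm]
  rcases eq_or_ne ‖z‖ 0 with h | h
  · simp [h]
  · field_simp

lemma perpKernel_neg (z : R2) : perpKernel (-z) = -perpKernel z := by
  simp [perpKernel, perp_neg]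

lemma inner_perpKernel_self (z : R2) : inner ℝ z (perpKernel z) = 0 := by
  rw [perpKernel, inner_smul_right, inner_perp_self, mul_zero]

@[fun_prop]
lemma measurable_perpKernel : Measurable perpKernel := by
  unfold perpKernel
  exact (measurable_norm.pow_const 2).inv.smul continuous_perp.measurable

lemma biotSavart_eq (w : R2 → ℝ) (x : R2) :
    biotSavart w x = (2 * π)⁻¹ • ∫ y, w y • perpKernel (x - y) := by
  simp only [biotSavart, perpKernel, smul_smul, div_eq_mul_inv]

/-- The part of `z ↦ |z|⁻¹` carried by the unit ball. -/
def invNormNear (z : R2) : ℝ := (Set.Iio (1 : ℝ)).indicator (fun r ↦ r⁻¹) ‖z‖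

lemma invNormNear_nonneg (z : R2) : 0 ≤ invNormNear z :=
  Set.indicator_apply_nonneg fun _ ↦ inv_nonneg.mpr (norm_nonneg z)

lemma inv_norm_le (z : R2) : ‖z‖⁻¹ ≤ invNormNear z + 1 := by
  by_cases h : ‖z‖ < 1
  · simp [invNormNear, h]
  · simpa [invNormNear, h] using inv_le_one_of_one_le₀ (not_lt.mp h)

lemma integrable_invNormNear : Integrable invNormNear := by
  unfold invNormNear
  rw [integrable_fun_norm_addHaar]
  simp only [finrank_euclideanSpace, Fintype.card_fin, Nat.add_one_sub_one, pow_one, smul_eq_mul]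
  have h : IntegrableOn ((Set.Iio (1 : ℝ)).indicator fun _ ↦ (1 : ℝ)) (Set.Ioi 0) := by
    rw [IntegrableOn, integrable_indicator_iff measurableSet_Iio]
    simp [IntegrableOn, Measure.restrict_restrict, Set.Iio_inter_Ioi]
  refine h.congr_fun (fun r (hr : 0 < r) ↦ ?_) measurableSet_Ioi
  by_cases h1 : r < 1 <;> simp [h1, hr.ne']

lemma integrable_smul_perpKernel {w : R2 → ℝ} (hw : Integrable w) {C : ℝ}
    (hC : ∀ y, ‖w y‖ ≤ C) (x : R2) : Integrable fun y ↦ w y • perpKernel (x - y) := by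
  refine Integrable.mono' (((integrable_invNormNear.comp_sub_left x).const_mul C).add hw.norm)
    (hw.aestronglyMeasurable.smul
      (measurable_perpKernel.comp (measurable_const.sub measurable_id)).aestronglyMeasurable)
    (ae_of_all _ fun y ↦ ?_)
  rw [norm_smul, norm_perpKernel]
  calc ‖w y‖ * ‖x - y‖⁻¹ ≤ ‖w y‖ * (invNormNear (x - y) + 1) := by
        gcongr
        exact inv_norm_le _
    _ = ‖w y‖ * invNormNear (x - y) + ‖w y‖ := by ring
    _ ≤ C * invNormNear (x - y) + ‖w y‖ := by
        gcongr
        · exact invNormNear_nonneg _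
        · exact hC y

lemma integrable_prod_smul_perpKernel {a w : R2 → ℝ} (ha : Integrable a) (hw : Integrable w)
    {C : ℝ} (hC : ∀ y, ‖w y‖ ≤ C) :
    Integrable (fun p : R2 × R2 ↦ (a p.1 * w p.2) • perpKernel (p.1 - p.2))
      (volume.prod volume) := by
  have hconv : Integrable (fun p : R2 × R2 ↦ ‖a p.1‖ * invNormNear (p.2 - p.1))
      (volume.prod volume) :=
    (ha.norm.convolution_integrand (ContinuousLinearMap.mul ℝ ℝ) integrable_invNormNear).swap
  refine Integrable.mono' ((hconv.const_mul C).add (ha.mul_prod hw).norm)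
    ((ha.mul_prod hw).aestronglyMeasurable.smul
      (measurable_perpKernel.comp (measurable_fst.sub measurable_snd)).aestronglyMeasurable)
    (ae_of_all _ fun p ↦ ?_)
  have hsymm : invNormNear (p.1 - p.2) = invNormNear (p.2 - p.1) := by
    rw [invNormNear, invNormNear, norm_sub_rev]
  rw [norm_smul, norm_perpKernel, Pi.add_apply, norm_mul]
  calc ‖a p.1‖ * ‖w p.2‖ * ‖p.1 - p.2‖⁻¹
      ≤ ‖a p.1‖ * ‖w p.2‖ * (invNormNear (p.2 - p.1) + 1) := by
        gcongr
        exact hsymm ▸ inv_norm_le _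
    _ = ‖w p.2‖ * (‖a p.1‖ * invNormNear (p.2 - p.1)) + ‖a p.1‖ * ‖w p.2‖ := by ring
    _ ≤ C * (‖a p.1‖ * invNormNear (p.2 - p.1)) + ‖a p.1‖ * ‖w p.2‖ := by
        gcongr
        · exact mul_nonneg (norm_nonneg _) (invNormNear_nonneg _)
        · exact hC p.2

lemma SchwartzMap.exists_norm_le (w : SchwartzMap R2 ℝ) : ∃ C, ∀ y, ‖w y‖ ≤ C :=
  ⟨_, w.norm_le_seminorm ℝ⟩

lemma integrable_prod_inner_perpKernel (w₁ w₂ : SchwartzMap R2 ℝ) :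
    Integrable (fun p : R2 × R2 ↦ w₂ p.1 * w₁ p.2 * inner ℝ p.1 (perpKernel (p.1 - p.2)))
      (volume.prod volume) := by
  obtain ⟨C, hC⟩ := w₁.exists_norm_le
  have ha : Integrable fun x ↦ ‖x‖ * w₂ x :=
    (w₂.integrable_pow_mul volume 1).mono (by fun_prop) (ae_of_all _ fun x ↦ by simp)
  refine (integrable_prod_smul_perpKernel ha w₁.integrable hC).mono ?_ (ae_of_all _ fun p ↦ ?_)
  · have hk : Measurable fun p : R2 × R2 ↦ perpKernel (p.1 - p.2) :=
      measurable_perpKernel.comp (measurable_fst.sub measurable_snd)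
    have hw : Measurable fun p : R2 × R2 ↦ w₂ p.1 * w₁ p.2 := by fun_prop
    exact (hw.mul (measurable_fst.inner hk)).aestronglyMeasurable
  · rw [norm_smul, norm_mul, norm_mul (‖p.1‖ * _), norm_mul ‖p.1‖, norm_norm, norm_mul]
    calc ‖w₂ p.1‖ * ‖w₁ p.2‖ * ‖inner ℝ p.1 (perpKernel (p.1 - p.2))‖
        ≤ ‖w₂ p.1‖ * ‖w₁ p.2‖ * (‖p.1‖ * ‖perpKernel (p.1 - p.2)‖) := by
          gcongr
          exact norm_inner_le_norm _ _
      _ = ‖p.1‖ * ‖w₂ p.1‖ * ‖w₁ p.2‖ * ‖perpKernel (p.1 - p.2)‖ := by ring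

lemma mul_inner_biotSavart (w₁ w₂ : SchwartzMap R2 ℝ) (x : R2) :
    w₂ x * inner ℝ x (biotSavart w₁ x) =
      (2 * π)⁻¹ * ∫ y, w₂ x * w₁ y * inner ℝ x (perpKernel (x - y)) := by
  obtain ⟨C, hC⟩ := w₁.exists_norm_le
  rw [biotSavart_eq, inner_smul_right,
    ← integral_inner (integrable_smul_perpKernel w₁.integrable hC x) x]
  simp only [inner_smul_right, mul_assoc, integral_const_mul]
  ring

lemma integrable_mul_inner_biotSavart (w₁ w₂ : SchwartzMap R2 ℝ) :
    Integrable fun x ↦ w₂ x * inner ℝ x (biotSavart w₁ x) := by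
  simp only [mul_inner_biotSavart]
  exact (integrable_prod_inner_perpKernel w₁ w₂).integral_prod_left.const_mul _

lemma integral_mul_inner_biotSavart_add (w₁ w₂ : SchwartzMap R2 ℝ) :
    (∫ x, w₂ x * inner ℝ x (biotSavart w₁ x)) + ∫ x, w₁ x * inner ℝ x (biotSavart w₂ x) = 0 := by
  have h₁ := integrable_prod_inner_perpKernel w₁ w₂
  have h₂ := integrable_prod_inner_perpKernel w₂ w₁
  simp only [mul_inner_biotSavart, integral_const_mul]
  rw [← integral_prod _ h₁, ← integral_prod _ h₂, ← integral_prod_swap, ← mul_add]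
  refine mul_eq_zero_of_right _ ((integral_add h₁.swap h₂).symm.trans ?_)
  refine integral_eq_zero_of_ae (ae_of_all _ fun p ↦ ?_)
  have hk : perpKernel (p.2 - p.1) = -perpKernel (p.1 - p.2) := by
    rw [← neg_sub, perpKernel_neg]
  have h := inner_perpKernel_self (p.1 - p.2)
  rw [inner_sub_left] at h
  simp only [Prod.fst_swap, Prod.snd_swap, Function.comp_apply, Pi.zero_apply, hk, inner_neg_right]
  linear_combination w₁ p.1 * w₂ p.2 * h

lemma Gv_pos (x : R2) : 0 < Gv x := by
  unfold Gv
  positivity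

lemma fderiv_Gv (x v : R2) : fderiv ℝ Gv x v = -(1 / 2) * inner ℝ x v * Gv x := by
  have h : HasFDerivAt Gv _ x :=
    (((hasStrictFDerivAt_norm_sq x).hasFDerivAt.neg.mul_const 4⁻¹).exp).const_mul (4 * π)⁻¹
  rw [h.fderiv]
  simp [Gv, div_eq_mul_inv]
  ring

/-- The factor `m(r)` such that `G⁻¹ v^G = m(|ξ|) ξ^⊥`. -/
def weightedOseenFactor (r : ℝ) : ℝ :=
  ((4 * π)⁻¹ * Real.exp (-r ^ 2 / 4))⁻¹ * ((2 * π)⁻¹ * (1 - Real.exp (-r ^ 2 / 4)) / r ^ 2)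

lemma weighted_Lam_add (w₁ w₂ : SchwartzMap R2 ℝ) (x : R2) :
    (Gv x)⁻¹ * (Lam w₁ x * w₂ x + w₁ x * Lam w₂ x) =
      weightedOseenFactor ‖x‖ * fderiv ℝ (fun y ↦ w₁ y * w₂ y) x (perp x) +
        -(1 / 2) * (w₂ x * inner ℝ x (biotSavart w₁ x) + w₁ x * inner ℝ x (biotSavart w₂ x)) := by
  have hG := (Gv_pos x).ne'
  have hm : weightedOseenFactor ‖x‖ =
      (Gv x)⁻¹ * ((2 * π)⁻¹ * (1 - Real.exp (-‖x‖ ^ 2 / 4)) / ‖x‖ ^ 2) := rfl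
  rw [hm, fderiv_fun_mul w₁.differentiableAt w₂.differentiableAt]
  simp only [Lam, fderiv_Gv, vG, map_smul, smul_eq_mul, add_apply,
    smul_apply]
  generalize (2 * π)⁻¹ * (1 - Real.exp (-‖x‖ ^ 2 / 4)) / ‖x‖ ^ 2 = c
  field_simp
  ring

/-- The operator `Λ` is skew-symmetric with respect to the
Gaussian-weighted inner product `⟨w₁,w₂⟩ = ∫ G⁻¹ w₁ w₂`. -/
theorem Lam_skew_symmetric (w₁ w₂ : SchwartzMap R2 ℝ) :
    ∫ ξ : R2, (Gv ξ)⁻¹ * (Lam (⇑w₁) ξ * w₂ ξ + w₁ ξ * Lam (⇑w₂) ξ) = 0 := by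
  have hB : Integrable fun x ↦ -(1 / 2 : ℝ) *
      (w₂ x * inner ℝ x (biotSavart w₁ x) + w₁ x * inner ℝ x (biotSavart w₂ x)) :=
    ((integrable_mul_inner_biotSavart w₁ w₂).add
      (integrable_mul_inner_biotSavart w₂ w₁)).const_mul _
  simp only [weighted_Lam_add]
  by_cases hA : Integrable fun x ↦
      weightedOseenFactor ‖x‖ * fderiv ℝ (fun y ↦ w₁ y * w₂ y) x (perp x)
  · rw [integral_add hA hB, integral_radial_mul_fderiv_perp ((w₁.smooth 1).mul (w₂.smooth 1)) hA,
      integral_const_mul, integral_add (integrable_mul_inner_biotSavart w₁ w₂)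
      (integrable_mul_inner_biotSavart w₂ w₁), integral_mul_inner_biotSavart_add]
    simp
  · exact integral_undef fun h ↦ hA ((integrable_add_iff_integrable_left hB).mp h)

end
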